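/- Let c ∈ O, let t > 0, and let f : O → ℝ be defined by f(x) = |x−c|^t. Then V_Berk(f) = 2(q−1)/(q − q^{−t}). In particular 1 < V_Berk(f) < 2. -/

import Mathlib

open MeasureTheory Set Filter Topology
open scoped ENNReal NNReal

noncomputable section

namespace NAKoksma

variable (K : Type*) [NontriviallyNormedField K] [IsUltrametricDist K]

/-- The ring of integers `O = {x : K | ‖x‖ ≤ 1}` of a non-Archimedean normed field. -/
def RoI : Subring K where
  carrier := {x : K | ‖x‖ ≤ 1}
  mul_mem' := fun {a b} ha hb => by
    simp only [Set.mem_setOf_eq] at *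
    calc ‖a * b‖ = ‖a‖ * ‖b‖ := norm_mul a b
      _ ≤ 1 * 1 := mul_le_mul ha hb (norm_nonneg b) zero_le_one
      _ = 1 := one_mul 1
  one_mem' := by simp
  add_mem' := fun {a b} ha hb => by
    simp only [Set.mem_setOf_eq] at *
    exact (IsUltrametricDist.norm_add_le_max a b).trans (max_le ha hb)
  zero_mem' := by simp
  neg_mem' := fun {a} ha => by
    simp only [Set.mem_setOf_eq, norm_neg] at *
    exact ha

variable (q : ℕ)

/-- The disc of radius `q ^ (-n)` centered at `a` in the ring of integers. -/
def disc (a : RoI K) (n : ℕ) : Set (RoI K) :=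
  {x : RoI K | ‖(x : K) - (a : K)‖ ≤ (q : ℝ) ^ (-(n : ℤ))}

/-- A subset of `O` is a disc if it is of the form `D_r(a)` with `r = q^(-n)`, `0 < r ≤ 1`. -/
def IsDisc (D : Set (RoI K)) : Prop := ∃ (a : RoI K) (n : ℕ), D = disc K q a n

/-- A Taibleson partition: a finite collection of discs partitioning `O`. -/
def IsTaibPartition (P : Finset (Set (RoI K))) : Prop :=
  (∀ D ∈ P, IsDisc K q D) ∧ (P : Set (Set (RoI K))).PairwiseDisjoint id ∧
    ⋃₀ (P : Set (Set (RoI K))) = Set.univ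

/-- `V_Π(f) = Σ_{D ∈ Π} sup_{x,y ∈ D} (f x - f y)`, valued in `[0,∞]`. -/
def VPi (f : RoI K → ℝ) (P : Finset (Set (RoI K))) : ℝ≥0∞ :=
  ∑ D ∈ P, ⨆ x ∈ D, ⨆ y ∈ D, ENNReal.ofReal (f x - f y)

/-- The Taibleson variation `V_Taib(f) = sup_Π V_Π(f)`. -/
def VTaib (f : RoI K → ℝ) : ℝ≥0∞ :=
  ⨆ P : {P : Finset (Set (RoI K)) // IsTaibPartition K q P}, VPi K f P.1

variable [MeasurableSpace K]

/-- The discrepancy `Δ(X) = sup_D | |X ∩ D| / |X| - μ(D) |` of a finite set `X ⊆ O`. -/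
def discrepancy (μ : Measure (RoI K)) (X : Finset (RoI K)) : ℝ :=
  ⨆ D : {D : Set (RoI K) // IsDisc K q D},
    |(Nat.card ↥((X : Set (RoI K)) ∩ D.1) : ℝ) / (X.card : ℝ) - (μ D.1).toReal|

variable (π : RoI K)

/-- The `i`-th point `m_i = a_0 + a_1 π + ⋯ + a_{λ-1} π^{λ-1}` in the dictionary
ordering of the coefficient strings `(a_0, …, a_{λ-1})` with respect to the
indexing of the coset representatives `S`. -/
def beerPoint (S : ℕ → RoI K) (lam i : ℕ) : RoI K :=
  ∑ j ∈ Finset.range lam, S (i / q ^ (lam - 1 - j) % q) * π ^ j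

/-- `V_λ(f) = sup_{x_i ∈ E_i} Σ_{i=1}^{q^λ - 1} |f(x_i) - f(x_{i-1})|` over the ordered Beer
partition `E_0, …, E_{q^λ - 1}` of level `λ`. -/
def VBeerLevel (S : ℕ → RoI K) (f : RoI K → ℝ) (lam : ℕ) : ℝ≥0∞ :=
  ⨆ x : {x : ℕ → RoI K // ∀ i < q ^ lam, x i ∈ disc K q (beerPoint K q π S lam i) lam},
    ∑ i ∈ Finset.Ico 1 (q ^ lam), ENNReal.ofReal |f (x.1 i) - f (x.1 (i - 1))|

/-- The Beer variation `V_Beer(f) = lim_{λ→∞} V_λ(f) = sup_{λ ≥ 1} V_λ(f)`. -/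
def VBeer (S : ℕ → RoI K) (f : RoI K → ℝ) : ℝ≥0∞ :=
  ⨆ lam : ℕ, VBeerLevel K q π S f (lam + 1)

/-- `S : ℕ → O` (through indices `0, …, q-1`) is a complete ordered system of coset
representatives for the residue field `O/πO`, containing `0`. -/
def IsRepSystem (S : ℕ → RoI K) : Prop :=
  (∃ i, i < q ∧ S i = 0) ∧
    Function.Bijective fun i : Fin q => Ideal.Quotient.mk (Ideal.span {π}) (S (i : ℕ))

/-- The Berkovich-analytic variation
`V_Berk(f) = Σ_D Σ_{D' ≺ D} |f(D') - f(D)|`, where `D' ≺ D` means `D' ⊆ D` and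
`μ(D') = μ(D)/q`, and `f(D)` denotes the average of `f` over `D`. -/
def VBerk (μ : Measure (RoI K)) (f : RoI K → ℝ) : ℝ≥0∞ :=
  ∑' D : {D : Set (RoI K) // IsDisc K q D},
    ∑' D' : {D' : Set (RoI K) // IsDisc K q D' ∧ D' ⊆ D.1 ∧ μ D' = μ D.1 / (q : ℝ≥0∞)},
      ENNReal.ofReal |(⨍ x in D'.1, f x ∂μ) - ⨍ x in D.1, f x ∂μ|

/-- The level `ℓ(γ)` of a character `γ : O → 𝕋`: the least `ℓ ≥ 0` such that `γ` is trivial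
on `π^ℓ O`. -/
def charLevel (γ : AddChar (RoI K) Circle) : ℕ :=
  sInf {l : ℕ | ∀ y : RoI K, γ (π ^ l * y) = 1}

/-- The Fourier coefficient `f̂(γ) = ∫_O f(x) conj(γ(x)) dμ(x)`. -/
def fourierCoeff (μ : Measure (RoI K)) (f : RoI K → ℂ) (γ : AddChar (RoI K) Circle) : ℂ :=
  ∫ x, f x * (starRingEnd ℂ) ((γ x : Circle) : ℂ) ∂μ

/-- The Fourier-analytic variation `V_Fourier(f) = Σ_{γ ≠ γ₀} q^{ℓ(γ)} |f̂(γ)|`, the sum over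
all nontrivial continuous characters of `O`. -/
def VFourier (μ : Measure (RoI K)) (f : RoI K → ℝ) : ℝ≥0∞ :=
  ∑' γ : {γ : AddChar (RoI K) Circle // Continuous ⇑γ ∧ γ ≠ 1},
    ENNReal.ofReal ((q : ℝ) ^ charLevel K π γ.1 * ‖fourierCoeff K μ (fun x => (f x : ℂ)) γ.1‖)

/-- A function is a finite linear combination of characteristic functions of discs. -/
def IsDiscSimple (g : RoI K → ℝ) : Prop :=
  ∃ (P : Finset (Set (RoI K))) (c : Set (RoI K) → ℝ),
    (∀ D ∈ P, IsDisc K q D) ∧ g = fun x => ∑ D ∈ P, c D * D.indicator 1 x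

/-- Integrability in the sense of Beer: `f` can be squeezed between finite linear combinations
of characteristic functions of discs with integrals converging to each other. -/
def BeerIntegrable [MeasurableSpace K] (μ : Measure (RoI K)) (f : RoI K → ℝ) : Prop :=
  ∃ u v : ℕ → RoI K → ℝ,
    (∀ n, IsDiscSimple K q (u n)) ∧ (∀ n, IsDiscSimple K q (v n)) ∧
    (∀ n x, u n x ≤ f x ∧ f x ≤ v n x) ∧
    Tendsto (fun n => ∫ x, (v n x - u n x) ∂μ) atTop (𝓝 0)

/-- `ϖ` is a uniformizer of `O`, with norm `q⁻¹` and residue ring of cardinality `q`. -/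
structure IsNormalizedUniformizer {F : Type*} [NontriviallyNormedField F] [IsUltrametricDist F]
    (q : ℕ) (ϖ : RoI F) : Prop where
  one_lt : 1 < q
  norm_eq : ‖(ϖ : F)‖ = (q : ℝ)⁻¹
  norm_le : ∀ x : RoI F, ‖(x : F)‖ < 1 → ‖(x : F)‖ ≤ ‖(ϖ : F)‖
  card_quotient : Nat.card (↥(RoI F) ⧸ (Ideal.span {ϖ} : Ideal ↥(RoI F))) = q

section Discs

variable {F : Type*} [NontriviallyNormedField F] [IsUltrametricDist F] {q : ℕ} {ϖ : RoI F}

theorem mem_disc {a x : RoI F} {n : ℕ} :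
    x ∈ disc F q a n ↔ ‖(x : F) - (a : F)‖ ≤ (q : ℝ) ^ (-(n : ℤ)) := Iff.rfl

theorem mem_disc_self (a : RoI F) (n : ℕ) : a ∈ disc F q a n := by
  simp only [mem_disc, sub_self, norm_zero]
  positivity

theorem norm_sub_le_max_norm_sub (x y z : F) : ‖x - z‖ ≤ max ‖x - y‖ ‖y - z‖ := by
  simpa [dist_eq_norm] using IsUltrametricDist.dist_triangle_max x y z

theorem disc_eq_of_mem {a b : RoI F} {n : ℕ} (h : b ∈ disc F q a n) :
    disc F q b n = disc F q a n := by
  rw [mem_disc] at h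
  ext x
  rw [mem_disc, mem_disc]
  constructor <;> intro hx
  · exact (norm_sub_le_max_norm_sub _ (b : F) _).trans (max_le hx h)
  · exact (norm_sub_le_max_norm_sub _ (a : F) _).trans (max_le hx (by rwa [norm_sub_rev]))

theorem isClosed_disc (a : RoI F) (n : ℕ) : IsClosed (disc F q a n) :=
  isClosed_le (by fun_prop) continuous_const

theorem disc_zero (a : RoI F) : disc F q a 0 = univ := by
  ext x
  have : ‖(x : F) - a‖ ≤ 1 := (x - a).2
  simpa [mem_disc] using this

/-- The subdisc of `disc a n` of level `n + 1` attached to a residue class `r`. -/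
def subdisc (q : ℕ) (ϖ a : RoI F) (n : ℕ) (r : ↥(RoI F) ⧸ (Ideal.span {ϖ} : Ideal ↥(RoI F))) :
    Set (RoI F) :=
  disc F q (a + ϖ ^ n * Quotient.out r) (n + 1)

namespace IsNormalizedUniformizer

variable (h : IsNormalizedUniformizer q ϖ)
include h

theorem cast_pos : (0 : ℝ) < q := by exact_mod_cast zero_lt_one.trans h.one_lt

theorem one_lt_cast : (1 : ℝ) < q := by exact_mod_cast h.one_lt

theorem rpow_neg_lt_one {t : ℝ} (ht : 0 < t) : (q : ℝ) ^ (-t) < 1 :=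
  Real.rpow_lt_one_of_one_lt_of_neg h.one_lt_cast (neg_lt_zero.2 ht)

theorem coe_ne_zero : (ϖ : F) ≠ 0 := by
  rw [← norm_pos_iff, h.norm_eq]
  exact inv_pos.2 h.cast_pos

theorem norm_pow (n : ℕ) : ‖(ϖ : F) ^ n‖ = (q : ℝ) ^ (-(n : ℤ)) := by
  rw [_root_.norm_pow, h.norm_eq, zpow_neg, zpow_natCast, inv_pow]

theorem finite_quotient : Finite (↥(RoI F) ⧸ (Ideal.span {ϖ} : Ideal ↥(RoI F))) :=
  Nat.finite_of_card_ne_zero (by rw [h.card_quotient]; exact (zero_lt_one.trans h.one_lt).ne')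

theorem exists_eq_pow_mul {x : RoI F} {n : ℕ} (hx : ‖(x : F)‖ ≤ (q : ℝ) ^ (-(n : ℤ))) :
    ∃ y : RoI F, x = ϖ ^ n * y := by
  have hϖ := pow_ne_zero n h.coe_ne_zero
  refine ⟨⟨(x : F) / (ϖ : F) ^ n, ?_⟩, ?_⟩
  · change ‖(x : F) / (ϖ : F) ^ n‖ ≤ 1
    rw [norm_div, h.norm_pow]
    exact div_le_one_of_le₀ hx (by positivity)
  · ext
    push_cast
    field_simp

theorem mem_span_iff {y : RoI F} : y ∈ Ideal.span {ϖ} ↔ ‖(y : F)‖ ≤ (q : ℝ)⁻¹ := by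
  rw [Ideal.mem_span_singleton]
  constructor
  · rintro ⟨z, rfl⟩
    have hz : ‖(z : F)‖ ≤ 1 := z.2
    rw [Subring.coe_mul, norm_mul, h.norm_eq]
    exact mul_le_of_le_one_right (inv_nonneg.2 h.cast_pos.le) hz
  · intro hy
    obtain ⟨z, hz⟩ := h.exists_eq_pow_mul (n := 1) (by simpa using hy)
    exact ⟨z, by simpa using hz⟩

theorem norm_pow_mul_le {y : RoI F} {n m : ℕ} :
    ‖(ϖ : F) ^ n * y‖ ≤ (q : ℝ) ^ (-((n + m : ℕ) : ℤ)) ↔ ‖(y : F)‖ ≤ (q : ℝ) ^ (-(m : ℤ)) := by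
  rw [norm_mul, h.norm_pow, Nat.cast_add, neg_add, zpow_add₀ h.cast_pos.ne']
  exact mul_le_mul_iff_right₀ (zpow_pos h.cast_pos _)

theorem add_pow_mul_mem_disc (a y : RoI F) (n : ℕ) : a + ϖ ^ n * y ∈ disc F q a n := by
  rw [mem_disc]
  push_cast
  rw [add_sub_cancel_left]
  have hy : ‖(y : F)‖ ≤ 1 := y.2
  exact (h.norm_pow_mul_le (m := 0)).2 (by simpa using hy)

theorem exists_eq_add_pow_mul {a x : RoI F} {n : ℕ} (hx : x ∈ disc F q a n) :
    ∃ y : RoI F, x = a + ϖ ^ n * y := by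
  obtain ⟨y, hy⟩ := h.exists_eq_pow_mul (x := x - a) (n := n) (by simpa [mem_disc] using hx)
  exact ⟨y, by rw [← hy]; ring⟩

theorem add_pow_mul_mem_subdisc {a y : RoI F} {n : ℕ}
    {r : ↥(RoI F) ⧸ (Ideal.span {ϖ} : Ideal ↥(RoI F))} :
    a + ϖ ^ n * y ∈ subdisc q ϖ a n r ↔ Ideal.Quotient.mk (Ideal.span {ϖ}) y = r := by
  have hr : r = Ideal.Quotient.mk (Ideal.span {ϖ}) (Quotient.out r) := (Quotient.out_eq r).symm
  conv_rhs => rw [hr, Ideal.Quotient.eq, h.mem_span_iff]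
  have := h.norm_pow_mul_le (y := y - Quotient.out r) (n := n) (m := 1)
  rw [subdisc, mem_disc]
  convert this using 2
  · push_cast
    congr 1
    ring
  · simp

theorem subdisc_subset (a : RoI F) (n : ℕ) (r : ↥(RoI F) ⧸ (Ideal.span {ϖ} : Ideal ↥(RoI F))) :
    subdisc q ϖ a n r ⊆ disc F q a n := by
  intro x hx
  rw [← disc_eq_of_mem (h.add_pow_mul_mem_disc a (Quotient.out r) n)]
  rw [subdisc, mem_disc] at hx
  rw [mem_disc]
  refine hx.trans (zpow_le_zpow_right₀ h.one_lt_cast.le ?_)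
  push_cast
  linarith

theorem mem_subdisc {a x : RoI F} {n : ℕ} (hx : x ∈ disc F q a n) :
    ∃ r, x ∈ subdisc q ϖ a n r := by
  obtain ⟨y, rfl⟩ := h.exists_eq_add_pow_mul hx
  exact ⟨_, h.add_pow_mul_mem_subdisc.2 rfl⟩

theorem iUnion_subdisc (a : RoI F) (n : ℕ) : ⋃ r, subdisc q ϖ a n r = disc F q a n :=
  Subset.antisymm (iUnion_subset (h.subdisc_subset a n))
    fun _ hx => mem_iUnion.2 (h.mem_subdisc hx)

theorem eq_of_mem_subdisc {a x : RoI F} {n : ℕ}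
    {r s : ↥(RoI F) ⧸ (Ideal.span {ϖ} : Ideal ↥(RoI F))}
    (hr : x ∈ subdisc q ϖ a n r) (hs : x ∈ subdisc q ϖ a n s) : r = s := by
  obtain ⟨y, rfl⟩ := h.exists_eq_add_pow_mul (h.subdisc_subset a n r hr)
  rw [h.add_pow_mul_mem_subdisc] at hr hs
  exact hr.symm.trans hs

theorem pairwise_disjoint_subdisc (a : RoI F) (n : ℕ) :
    Pairwise (Function.onFun Disjoint (subdisc q ϖ a n)) := fun _ _ hne =>
  Set.disjoint_left.2 fun _ hr hs => hne (h.eq_of_mem_subdisc hr hs)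

theorem subdisc_zero (a : RoI F) (n : ℕ) : subdisc q ϖ a n 0 = disc F q a (n + 1) := by
  have : a ∈ subdisc q ϖ a n 0 := by
    simpa using (h.add_pow_mul_mem_subdisc (a := a) (y := 0) (n := n) (r := 0)).2 (map_zero _)
  exact (disc_eq_of_mem this).symm

theorem norm_sub_eq {c x : RoI F} {n : ℕ} (hx : x ∈ disc F q c n)
    (hx' : x ∉ disc F q c (n + 1)) : ‖(x : F) - c‖ = (q : ℝ) ^ (-(n : ℤ)) := by
  obtain ⟨y, rfl⟩ := h.exists_eq_add_pow_mul hx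
  rw [← h.subdisc_zero, h.add_pow_mul_mem_subdisc, Ideal.Quotient.eq_zero_iff_mem,
    h.mem_span_iff, ← h.norm_eq] at hx'
  have hy : ‖(y : F)‖ = 1 := by
    by_contra hne
    exact hx' (h.norm_le y (lt_of_le_of_ne y.2 hne))
  push_cast
  rw [add_sub_cancel_left, norm_mul, h.norm_pow, hy, mul_one]

end IsNormalizedUniformizer

theorem norm_sub_eq_of_notMem {b c x : RoI F} {n : ℕ} (hx : x ∈ disc F q b n)
    (hc : c ∉ disc F q b n) : ‖(x : F) - c‖ = ‖(b : F) - c‖ := by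
  rw [mem_disc] at hx hc
  rw [norm_sub_rev, not_le] at hc
  have hlt := hx.trans_lt hc
  have := IsUltrametricDist.norm_add_eq_max_of_norm_ne_norm hlt.ne
  rw [sub_add_sub_cancel, max_eq_right hlt.le] at this
  exact this

end Discs

section Averages

variable {F : Type*} [NontriviallyNormedField F] [IsUltrametricDist F] [MeasurableSpace F]
  [BorelSpace F] {q : ℕ} {ϖ : RoI F} (μ : Measure (RoI F))

theorem measurableSet_disc (a : RoI F) (n : ℕ) : MeasurableSet (disc F q a n) :=
  (isClosed_disc a n).measurableSet

theorem measure_disc_eq_measure_disc [μ.IsAddLeftInvariant] (a b : RoI F) (n : ℕ) :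
    μ (disc F q a n) = μ (disc F q b n) := by
  rw [← measure_preimage_add μ (b - a) (disc F q b n)]
  congr 1
  ext x
  simp only [mem_disc, mem_preimage]
  push_cast
  rw [show (b : F) - a + x - b = x - a by ring]

theorem integrable_norm_sub_rpow [IsProbabilityMeasure μ] (c : RoI F) {t : ℝ} (ht : 0 < t) :
    Integrable (fun x : RoI F => ‖(x : F) - c‖ ^ t) μ := by
  have hcont : Continuous fun x : RoI F => ‖(x : F) - c‖ ^ t :=
    Continuous.rpow_const (by fun_prop) fun _ => Or.inr ht.le
  refine Integrable.of_bound hcont.measurable.aestronglyMeasurable 1 (ae_of_all _ fun x => ?_)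
  have hx : ‖(x : F) - c‖ ≤ 1 := (x - c).2
  rw [Real.norm_of_nonneg (by positivity)]
  exact Real.rpow_le_one (norm_nonneg _) hx ht.le

namespace IsNormalizedUniformizer

variable (h : IsNormalizedUniformizer q ϖ)
include h

theorem measure_disc [IsProbabilityMeasure μ] [μ.IsAddLeftInvariant] (a : RoI F) (n : ℕ) :
    μ (disc F q a n) = ((q : ℝ≥0∞)⁻¹) ^ n := by
  have := h.finite_quotient
  have := Fintype.ofFinite (↥(RoI F) ⧸ (Ideal.span {ϖ} : Ideal ↥(RoI F)))
  induction n with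
  | zero => rw [disc_zero, measure_univ, pow_zero]
  | succ n ih =>
    rw [← h.iUnion_subdisc a n, measure_iUnion (h.pairwise_disjoint_subdisc a n)
      fun r => measurableSet_disc _ _, tsum_fintype] at ih
    simp only [subdisc, fun r => measure_disc_eq_measure_disc μ
      (a + ϖ ^ n * Quotient.out r) a (n + 1) (q := q)] at ih
    rw [Finset.sum_const, Finset.card_univ, ← Nat.card_eq_fintype_card, h.card_quotient,
      nsmul_eq_mul] at ih
    have hq0 : (q : ℝ≥0∞) ≠ 0 := by exact_mod_cast (zero_lt_one.trans h.one_lt).ne'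
    rw [pow_succ, ← ih, mul_comm, ← mul_assoc,
      ENNReal.inv_mul_cancel hq0 (ENNReal.natCast_ne_top q), one_mul]

theorem measureReal_disc [IsProbabilityMeasure μ] [μ.IsAddLeftInvariant] (a : RoI F) (n : ℕ) :
    μ.real (disc F q a n) = ((q : ℝ)⁻¹) ^ n := by
  simp [Measure.real, h.measure_disc μ]

theorem setAverage_eq_of_forall [IsProbabilityMeasure μ] [μ.IsAddLeftInvariant] {a : RoI F}
    {n : ℕ} {f : RoI F → ℝ} {v : ℝ} (hf : ∀ x ∈ disc F q a n, f x = v) :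
    ⨍ x in disc F q a n, f x ∂μ = v := by
  rw [setAverage_congr_fun (measurableSet_disc a n) (ae_of_all _ hf)]
  refine setAverage_const ?_ (measure_ne_top _ _) v
  rw [h.measure_disc μ]
  exact pow_ne_zero _ (ENNReal.inv_ne_zero.2 (ENNReal.natCast_ne_top q))

theorem sum_setAverage_subdisc [IsProbabilityMeasure μ] [μ.IsAddLeftInvariant]
    [Fintype (↥(RoI F) ⧸ (Ideal.span {ϖ} : Ideal ↥(RoI F)))]
    {f : RoI F → ℝ} (hf : Integrable f μ) (a : RoI F) (n : ℕ) :
    ∑ r, ⨍ x in subdisc q ϖ a n r, f x ∂μ = q * ⨍ x in disc F q a n, f x ∂μ := by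
  have hq := h.cast_pos
  simp only [setAverage_eq, smul_eq_mul]
  rw [h.measureReal_disc μ, ← h.iUnion_subdisc a n,
    integral_iUnion_fintype (s := subdisc q ϖ a n) (fun r => measurableSet_disc _ _)
      (h.pairwise_disjoint_subdisc a n) fun r => hf.integrableOn, Finset.mul_sum, Finset.mul_sum]
  refine Finset.sum_congr rfl fun r _ => ?_
  rw [subdisc, h.measureReal_disc μ, pow_succ]
  field_simp

theorem level_eq_succ [IsProbabilityMeasure μ] [μ.IsAddLeftInvariant] {a b : RoI F} {n m : ℕ}
    (hm : μ (disc F q b m) = μ (disc F q a n) / q) : m = n + 1 := by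
  rw [h.measure_disc μ, h.measure_disc μ, ENNReal.div_eq_inv_mul, ← pow_succ'] at hm
  have := congrArg ENNReal.toReal hm
  simp only [ENNReal.toReal_pow, ENNReal.toReal_inv, ENNReal.toReal_natCast] at this
  exact pow_right_injective₀ (inv_pos.2 h.cast_pos) (inv_lt_one_of_one_lt₀ h.one_lt_cast).ne this

/-- The discs `D' ≺ disc a n` are the subdiscs attached to the residue classes. -/
theorem tsum_subdisc [IsProbabilityMeasure μ] [μ.IsAddLeftInvariant] (a : RoI F) (n : ℕ)
    (g : Set (RoI F) → ℝ≥0∞) :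
    ∑' D' : {D' : Set (RoI F) // IsDisc F q D' ∧ D' ⊆ disc F q a n ∧
      μ D' = μ (disc F q a n) / (q : ℝ≥0∞)}, g D'.1 = ∑' r, g (subdisc q ϖ a n r) := by
  let e : (↥(RoI F) ⧸ (Ideal.span {ϖ} : Ideal ↥(RoI F))) →
      {D' : Set (RoI F) // IsDisc F q D' ∧ D' ⊆ disc F q a n ∧
        μ D' = μ (disc F q a n) / (q : ℝ≥0∞)} := fun r =>
    ⟨subdisc q ϖ a n r, ⟨_, _, rfl⟩, h.subdisc_subset a n r, by
      rw [subdisc, h.measure_disc μ, h.measure_disc μ, ENNReal.div_eq_inv_mul, ← pow_succ']⟩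
  have he : Function.Bijective e := by
    constructor
    · intro r s hrs
      have hset : subdisc q ϖ a n r = subdisc q ϖ a n s := congrArg Subtype.val hrs
      have hmem : a + ϖ ^ n * Quotient.out r ∈ subdisc q ϖ a n r := mem_disc_self _ _
      exact h.eq_of_mem_subdisc hmem (hset ▸ hmem)
    · rintro ⟨D', ⟨b, m, rfl⟩, hsub, hμ⟩
      obtain rfl := h.level_eq_succ μ hμ
      obtain ⟨r, hr⟩ := h.mem_subdisc (hsub (mem_disc_self b _))
      exact ⟨r, Subtype.ext (disc_eq_of_mem hr).symm⟩
  exact ((Equiv.ofBijective e he).tsum_eq fun D' => g D'.1).symm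

theorem setAverage_subdisc_of_ne_zero [IsProbabilityMeasure μ] [μ.IsAddLeftInvariant]
    (c : RoI F) (t : ℝ) (n : ℕ) {r : ↥(RoI F) ⧸ (Ideal.span {ϖ} : Ideal ↥(RoI F))}
    (hr : r ≠ 0) :
    ⨍ x in subdisc q ϖ c n r, ‖(x : F) - c‖ ^ t ∂μ = ((q : ℝ) ^ (-t)) ^ n := by
  refine h.setAverage_eq_of_forall μ fun x hx => ?_
  have hx' : x ∉ disc F q c (n + 1) := fun hmem =>
    hr (h.eq_of_mem_subdisc hx (by rwa [h.subdisc_zero]))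
  rw [h.norm_sub_eq (h.subdisc_subset c n r hx) hx', ← Real.rpow_intCast,
    ← Real.rpow_natCast, ← Real.rpow_mul h.cast_pos.le, ← Real.rpow_mul h.cast_pos.le]
  push_cast
  congr 1
  ring

theorem setAverage_disc_succ [IsProbabilityMeasure μ] [μ.IsAddLeftInvariant]
    (c : RoI F) {t : ℝ} (ht : 0 < t) (n : ℕ) :
    ⨍ x in disc F q c (n + 1), ‖(x : F) - c‖ ^ t ∂μ + (q - 1) * ((q : ℝ) ^ (-t)) ^ n =
      q * ⨍ x in disc F q c n, ‖(x : F) - c‖ ^ t ∂μ := by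
  classical
  have := h.finite_quotient
  have := Fintype.ofFinite (↥(RoI F) ⧸ (Ideal.span {ϖ} : Ideal ↥(RoI F)))
  rw [← h.sum_setAverage_subdisc μ (integrable_norm_sub_rpow μ c ht) c n,
    ← Finset.add_sum_erase _ _ (Finset.mem_univ 0), h.subdisc_zero,
    Finset.sum_congr rfl fun r hr =>
      h.setAverage_subdisc_of_ne_zero μ c t n (Finset.ne_of_mem_erase hr),
    Finset.sum_const, Finset.card_erase_of_mem (Finset.mem_univ _), Finset.card_univ,
    ← Nat.card_eq_fintype_card, h.card_quotient, nsmul_eq_mul, Nat.cast_pred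
      (zero_lt_one.trans h.one_lt)]

theorem abs_setAverage_norm_sub_rpow_le_one [IsProbabilityMeasure μ] [μ.IsAddLeftInvariant]
    (c : RoI F) {t : ℝ} (ht : 0 < t) (n : ℕ) :
    |⨍ x in disc F q c n, ‖(x : F) - c‖ ^ t ∂μ| ≤ 1 := by
  have hpos : 0 < μ.real (disc F q c n) := by
    rw [h.measureReal_disc μ]
    exact pow_pos (inv_pos.2 h.cast_pos) n
  have hle := norm_setIntegral_le_of_norm_le_const (μ := μ) (s := disc F q c n)
    (f := fun x : RoI F => ‖(x : F) - c‖ ^ t) (C := 1) (measure_lt_top _ _) fun x _ => by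
      have hx : ‖(x : F) - c‖ ≤ 1 := (x - c).2
      rw [Real.norm_of_nonneg (by positivity)]
      exact Real.rpow_le_one (norm_nonneg _) hx ht.le
  rw [setAverage_eq, smul_eq_mul, abs_mul, abs_of_pos (inv_pos.2 hpos), inv_mul_le_iff₀ hpos]
  rw [Real.norm_eq_abs, one_mul] at hle
  rwa [mul_one]

/-- The average of `‖x - c‖ ^ t` over `disc c n`. -/
theorem setAverage_disc [IsProbabilityMeasure μ] [μ.IsAddLeftInvariant]
    (c : RoI F) {t : ℝ} (ht : 0 < t) (n : ℕ) :
    ⨍ x in disc F q c n, ‖(x : F) - c‖ ^ t ∂μ =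
      (q - 1) / (q - (q : ℝ) ^ (-t)) * ((q : ℝ) ^ (-t)) ^ n := by
  have hq := h.one_lt_cast
  set u := (q : ℝ) ^ (-t)
  have hu : u < 1 := h.rpow_neg_lt_one ht
  have hu0 : 0 < u := Real.rpow_pos_of_pos h.cast_pos _
  have hqu : 0 < q - u := by linarith
  set A : ℕ → ℝ := fun n => ⨍ x in disc F q c n, ‖(x : F) - c‖ ^ t ∂μ with hA
  set B : ℝ := (q - 1) / (q - u) with hB
  have hB0 : 0 < B := div_pos (by linarith) hqu
  have hB1 : B < 1 := (div_lt_one hqu).2 (by linarith)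
  have hBeq : B * (q - u) = q - 1 := div_mul_cancel₀ _ hqu.ne'
  have hrec : ∀ k, A (n + k) - B * u ^ (n + k) = q ^ k * (A n - B * u ^ n) := by
    intro k
    induction k with
    | zero => simp
    | succ k ih =>
      have hs := h.setAverage_disc_succ μ c ht (n + k)
      change A (n + k + 1) + _ = q * A (n + k) at hs
      rw [← add_assoc, pow_succ' (q : ℝ), mul_assoc, ← ih, pow_succ u]
      linear_combination hs + u ^ (n + k) * hBeq
  have hbound : ∀ k, q ^ k * |A n - B * u ^ n| ≤ 2 := by
    intro k
    have h1 := abs_le.1 (h.abs_setAverage_norm_sub_rpow_le_one μ c ht (n + k))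
    have h2 : u ^ (n + k) ≤ 1 := pow_le_one₀ hu0.le hu.le
    have h3 : 0 < u ^ (n + k) := pow_pos hu0 _
    rw [← abs_of_pos (pow_pos h.cast_pos k), ← abs_mul, ← hrec k, abs_le]
    constructor <;> simp only [hA] <;> nlinarith
  by_contra hne
  have hpos : 0 < |A n - B * u ^ n| := abs_pos.2 (sub_ne_zero.2 hne)
  obtain ⟨k, hk⟩ := pow_unbounded_of_one_lt (2 / |A n - B * u ^ n|) hq
  exact absurd (hbound k) (not_le.2 ((div_lt_iff₀ hpos).1 hk))

/-- The contribution of `disc c n` to the variation of `‖x - c‖ ^ t`. -/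
theorem tsum_abs_setAverage_sub [IsProbabilityMeasure μ] [μ.IsAddLeftInvariant]
    (c : RoI F) {t : ℝ} (ht : 0 < t) (n : ℕ) :
    ∑' r, ENNReal.ofReal |(⨍ x in subdisc q ϖ c n r, ‖(x : F) - c‖ ^ t ∂μ) -
        ⨍ x in disc F q c n, ‖(x : F) - c‖ ^ t ∂μ| =
      ENNReal.ofReal (2 * (q - 1) / (q - (q : ℝ) ^ (-t)) * (1 - (q : ℝ) ^ (-t)) *
        ((q : ℝ) ^ (-t)) ^ n) := by
  classical
  have := h.finite_quotient
  have := Fintype.ofFinite (↥(RoI F) ⧸ (Ideal.span {ϖ} : Ideal ↥(RoI F)))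
  rw [tsum_fintype, ← ENNReal.ofReal_sum_of_nonneg fun _ _ => abs_nonneg _,
    ← Finset.add_sum_erase _ _ (Finset.mem_univ 0), h.subdisc_zero,
    Finset.sum_congr rfl fun r hr => by
      rw [h.setAverage_subdisc_of_ne_zero μ c t n (Finset.ne_of_mem_erase hr)],
    Finset.sum_const, Finset.card_erase_of_mem (Finset.mem_univ _), Finset.card_univ,
    ← Nat.card_eq_fintype_card, h.card_quotient, nsmul_eq_mul, Nat.cast_pred
      (zero_lt_one.trans h.one_lt), h.setAverage_disc μ c ht, h.setAverage_disc μ c ht]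
  have hq := h.one_lt_cast
  have hu : (q : ℝ) ^ (-t) < 1 := h.rpow_neg_lt_one ht
  have hu0 : 0 < (q : ℝ) ^ (-t) := Real.rpow_pos_of_pos h.cast_pos _
  set u := (q : ℝ) ^ (-t)
  have hqu : 0 < q - u := by linarith
  have hun : 0 < u ^ n := pow_pos hu0 n
  have e1 : (q - 1) / (q - u) * u ^ (n + 1) - (q - 1) / (q - u) * u ^ n =
      -((q - 1) / (q - u) * (1 - u) * u ^ n) := by ring
  have e2 : u ^ n - (q - 1) / (q - u) * u ^ n = (1 - u) / (q - u) * u ^ n := by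
    field_simp
    ring
  have p1 : 0 < (q - 1) / (q - u) * (1 - u) * u ^ n :=
    mul_pos (mul_pos (div_pos (by linarith) hqu) (by linarith)) hun
  have p2 : 0 < (1 - u) / (q - u) * u ^ n := mul_pos (div_pos (by linarith) hqu) hun
  rw [e1, e2, abs_neg, abs_of_pos p1, abs_of_pos p2]
  congr 1
  ring

theorem VBerk_norm_sub_rpow [IsProbabilityMeasure μ] [μ.IsAddLeftInvariant]
    (c : RoI F) {t : ℝ} (ht : 0 < t) :
    VBerk F q μ (fun x => ‖(x : F) - c‖ ^ t) =
      ENNReal.ofReal (2 * (q - 1) / (q - (q : ℝ) ^ (-t))) := by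
  let i : ℕ → {D : Set (RoI F) // IsDisc F q D} := fun n => ⟨disc F q c n, c, n, rfl⟩
  have hi : Function.Injective i := by
    intro n m hnm
    have := congrArg (fun D => μ.real D.1) hnm
    simp only [i, h.measureReal_disc μ] at this
    exact pow_right_injective₀ (inv_pos.2 h.cast_pos)
      (inv_lt_one_of_one_lt₀ h.one_lt_cast).ne this
  have hq := h.one_lt_cast
  have hu : (q : ℝ) ^ (-t) < 1 := h.rpow_neg_lt_one ht
  have hu0 : 0 < (q : ℝ) ^ (-t) := Real.rpow_pos_of_pos h.cast_pos _
  unfold VBerk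
  rw [← hi.tsum_eq]
  · simp only [i]
    have hterm : ∀ n, _ := fun n => (h.tsum_subdisc μ c n fun D' =>
      ENNReal.ofReal |(⨍ x in D', ‖(x : F) - c‖ ^ t ∂μ) -
        ⨍ x in disc F q c n, ‖(x : F) - c‖ ^ t ∂μ|).trans (h.tsum_abs_setAverage_sub μ c ht n)
    rw [tsum_congr hterm]
    set u := (q : ℝ) ^ (-t)
    have hC : 0 ≤ 2 * (q - 1) / (q - u) * (1 - u) :=
      mul_nonneg (div_nonneg (by linarith) (by linarith)) (by linarith)
    rw [← ENNReal.ofReal_tsum_of_nonneg (fun n => mul_nonneg hC (pow_pos hu0 n).le)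
      ((summable_geometric_of_lt_one hu0.le hu).mul_left _), tsum_mul_left,
      tsum_geometric_of_lt_one hu0.le hu, mul_assoc, mul_inv_cancel₀ (by linarith), mul_one]
  · rintro ⟨_, a, n, rfl⟩ hD
    by_contra hrange
    have hc : c ∉ disc F q a n := fun hc =>
      hrange ⟨n, Subtype.ext (disc_eq_of_mem hc)⟩
    refine hD ?_
    refine (h.tsum_subdisc μ a n fun D' =>
      ENNReal.ofReal |(⨍ x in D', ‖(x : F) - c‖ ^ t ∂μ) -
        ⨍ x in disc F q a n, ‖(x : F) - c‖ ^ t ∂μ|).trans (ENNReal.tsum_eq_zero.2 fun r => ?_)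
    have hconst : ∀ x ∈ disc F q a n, ‖(x : F) - c‖ ^ t = ‖(a : F) - c‖ ^ t := fun x hx => by
      rw [norm_sub_eq_of_notMem hx hc]
    rw [h.setAverage_eq_of_forall μ hconst, subdisc,
      h.setAverage_eq_of_forall μ fun x hx => hconst x (h.subdisc_subset a n r hx), sub_self,
      abs_zero, ENNReal.ofReal_zero]

end IsNormalizedUniformizer

end Averages

variable [LocallyCompactSpace K] [BorelSpace K]

theorem VBerk_dist_rpow
    (hq : 1 < q)
    (hπ : ‖(π : K)‖ = (q : ℝ)⁻¹)
    (hunif : ∀ x : RoI K, ‖(x : K)‖ < 1 → ‖(x : K)‖ ≤ ‖(π : K)‖)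
    (hres : Nat.card (↥(RoI K) ⧸ (Ideal.span {π} : Ideal ↥(RoI K))) = q)
    (μ : Measure (RoI K)) [IsProbabilityMeasure μ] [μ.IsAddHaarMeasure]
    (c : RoI K) (t : ℝ) (ht : 0 < t) :
    VBerk K q μ (fun x => ‖(x : K) - (c : K)‖ ^ t) =
        ENNReal.ofReal (2 * ((q : ℝ) - 1) / ((q : ℝ) - (q : ℝ) ^ (-t))) ∧
      1 < VBerk K q μ (fun x => ‖(x : K) - (c : K)‖ ^ t) ∧
      VBerk K q μ (fun x => ‖(x : K) - (c : K)‖ ^ t) < 2 := by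
  have h : IsNormalizedUniformizer q π := ⟨hq, hπ, hunif, hres⟩
  have hq1 := h.one_lt_cast
  have hq2 : (2 : ℝ) ≤ q := by exact_mod_cast hq
  have hu : (q : ℝ) ^ (-t) < 1 := h.rpow_neg_lt_one ht
  have hu0 : 0 < (q : ℝ) ^ (-t) := Real.rpow_pos_of_pos h.cast_pos _
  have hpos : 0 < (q : ℝ) - (q : ℝ) ^ (-t) := by linarith
  rw [h.VBerk_norm_sub_rpow μ c ht]
  refine ⟨rfl, ?_, ?_⟩
  · rw [ENNReal.one_lt_ofReal, one_lt_div hpos]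
    linarith
  · rw [← ENNReal.ofReal_ofNat 2, ENNReal.ofReal_lt_ofReal_iff two_pos, div_lt_iff₀ hpos]
    linarith

end NAKoksma
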